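/- arXiv:2508.12374 — 3 statements merged into one kernel-verified Lean document; each statement's English description precedes it below -/
import Mathlib

section
/- Let X be a compact Hausdorff space, x_0 a point of X, and P an ideal of the TRO V. If I_{x_0,P} := {f ∈ C(X,V) : f(x_0) ∈ P} is a primal ideal of C(X,V), then P is a primal ideal of V. -/
noncomputable section

open ContinuousLinearMap

variable {H K : Type*} [NormedAddCommGroup H] [InnerProductSpace ℂ H] [CompleteSpace H]
  [NormedAddCommGroup K] [InnerProductSpace ℂ K] [CompleteSpace K]

/-- The ternary product `x y* z` on `B(H,K)`. -/
def tri (x y z : H →L[ℂ] K) : H →L[ℂ] K :=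
  x ∘L (ContinuousLinearMap.adjoint y ∘L z)

/-- The pointwise ternary product on continuous `B(H,K)`-valued maps. -/
def ctri {X : Type*} [TopologicalSpace X] (f g h : C(X, H →L[ℂ] K)) : C(X, H →L[ℂ] K) :=
  ⟨fun x => tri (f x) (g x) (h x),
    f.continuous.clm_comp
      (((ContinuousLinearMap.adjoint :
          (H →L[ℂ] K) ≃ₗᵢ⋆[ℂ] (K →L[ℂ] H)).continuous.comp g.continuous).clm_comp
        h.continuous)⟩

/-- `C(X,V)`: continuous maps `X → B(H,K)` taking values in `V`, as a subset of
`C(X, B(H,K))`. -/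
def CXV (X : Type*) [TopologicalSpace X] (V : Set (H →L[ℂ] K)) : Set C(X, H →L[ℂ] K) :=
  {f | ∀ x, f x ∈ V}

section Ideals

variable {E : Type*} [AddCommGroup E] [Module ℂ E] [TopologicalSpace E]

/-- `I` is a (closed) ideal of the TRO-like set `V`, with respect to the ternary
product `t`. -/
structure IsIdealT (t : E → E → E → E) (V I : Set E) : Prop where
  subset : I ⊆ V
  isClosed : IsClosed I
  zero_mem : (0 : E) ∈ I
  add_mem : ∀ a b, a ∈ I → b ∈ I → a + b ∈ I
  smul_mem : ∀ (c : ℂ), ∀ a, a ∈ I → c • a ∈ I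
  tri_mem_left : ∀ a b c, a ∈ I → b ∈ V → c ∈ V → t a b c ∈ I
  tri_mem_right : ∀ a b c, a ∈ V → b ∈ V → c ∈ I → t a b c ∈ I

/-- The odd product `j₁ j₂* j₃ ⋯ j₂ₙ* j₂ₙ₊₁` of a `(2n+1)`-tuple, with respect to the
ternary product `t`. -/
def oddProdT (t : E → E → E → E) : (n : ℕ) → (Fin (2 * n + 1) → E) → E
  | 0, j => j 0
  | n + 1, j =>
      t (oddProdT t n fun i => j (Fin.castLE (by omega) i))
        (j ⟨2 * n + 1, by omega⟩) (j ⟨2 * n + 2, by omega⟩)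

/-- `P` is a primal ideal of `V` with respect to the ternary product `t`. -/
def IsPrimalT (t : E → E → E → E) (V P : Set E) : Prop :=
  IsIdealT t V P ∧
    ∀ n : ℕ, 1 ≤ n → ∀ J : Fin (2 * n + 1) → Set E, (∀ i, IsIdealT t V (J i)) →
      (∀ j : Fin (2 * n + 1) → E, (∀ i, j i ∈ J i) → oddProdT t n j = 0) →
      ∃ k, J k ⊆ P

end Ideals

theorem CXV_ideal {X : Type*} [TopologicalSpace X] (V J : Set (H →L[ℂ] K))
    (hJ : IsIdealT (tri (H := H) (K := K)) V J) :
    IsIdealT (ctri (X := X)) (CXV X V) (CXV X J) where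
  subset := fun f hf x => hJ.subset (hf x)
  isClosed := by
    have h : CXV X J = ⋂ x : X, (fun f : C(X, H →L[ℂ] K) => f x) ⁻¹' J := by
      ext f
      simp [CXV]
    rw [h]
    exact isClosed_iInter fun x => hJ.isClosed.preimage (continuous_eval_const x)
  zero_mem := fun _ => hJ.zero_mem
  add_mem := fun a b ha hb x => hJ.add_mem _ _ (ha x) (hb x)
  smul_mem := fun c a ha x => hJ.smul_mem c _ (ha x)
  tri_mem_left := fun a b c ha hb hc x => hJ.tri_mem_left _ _ _ (ha x) (hb x) (hc x)
  tri_mem_right := fun a b c ha hb hc x => hJ.tri_mem_right _ _ _ (ha x) (hb x) (hc x)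

theorem oddProdT_eval {X : Type*} [TopologicalSpace X] (x : X) :
    ∀ (n : ℕ) (j : Fin (2 * n + 1) → C(X, H →L[ℂ] K)),
      oddProdT (ctri (X := X)) n j x = oddProdT (tri (H := H) (K := K)) n (fun i => j i x)
  | 0, _ => rfl
  | n + 1, j => by
    have ih := oddProdT_eval x n (fun i => j (Fin.castLE (by omega) i))
    simp only [oddProdT]
    rw [← ih]
    rfl

/-- If `X` is a compact Hausdorff space, `x₀ ∈ X`, `P` is an ideal of
the TRO `V`, and `I_{x₀,P} = {f ∈ C(X,V) : f x₀ ∈ P}` is a primal ideal of `C(X,V)`,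
then `P` is a primal ideal of `V`. -/
theorem primal_of_primal_eval_ideal
    {X : Type*} [TopologicalSpace X] [CompactSpace X] [T2Space X] (x₀ : X)
    (V : Set (H →L[ℂ] K)) (hV : IsIdealT (tri (H := H) (K := K)) V V)
    (P : Set (H →L[ℂ] K)) (hP : IsIdealT tri V P)
    (hprimal : IsPrimalT (ctri (X := X)) (CXV X V)
      {f : C(X, H →L[ℂ] K) | f ∈ CXV X V ∧ f x₀ ∈ P}) :
    IsPrimalT tri V P := by
  refine ⟨hP, fun n hn J hJ h0 => ?_⟩
  obtain ⟨k, hk⟩ := hprimal.2 n hn (fun i => CXV X (J i)) (fun i => CXV_ideal V (J i) (hJ i))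
    (fun j hj => by
      ext1 x
      rw [oddProdT_eval]
      exact h0 _ fun i => hj i x)
  refine ⟨k, fun a ha => ?_⟩
  have h : ContinuousMap.const X a ∈ CXV X (J k) := fun _ => ha
  exact (hk h).2
end
end

section
/- Let A be a C*-algebra, X a compact Hausdorff space, and I a primal ideal of C(X,A). Then there exist a point x_0 ∈ X and a primal ideal P of A such that I = I_{x_0,P} := {f ∈ C(X,A) : f(x_0) ∈ P}. -/
noncomputable section

/-- The product `a 0 * a 1 * ⋯ * a n` of a nonempty tuple (grouped to the left). -/
def finProd {R : Type*} [Mul R] : (n : ℕ) → (Fin (n + 1) → R) → R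
  | 0, a => a 0
  | n + 1, a => finProd n (fun i => a i.castSucc) * a (Fin.last (n + 1))

section Ideals

variable {R : Type*} [NonUnitalRing R] [TopologicalSpace R]

/-- `I` is a norm-closed two-sided ideal of `R`. -/
structure IsClosedIdealR (I : Set R) : Prop where
  isClosed : IsClosed I
  zero_mem : (0 : R) ∈ I
  add_mem : ∀ a b, a ∈ I → b ∈ I → a + b ∈ I
  neg_mem : ∀ a, a ∈ I → -a ∈ I
  mul_mem_left : ∀ a b, b ∈ I → a * b ∈ I
  mul_mem_right : ∀ a b, a ∈ I → a * b ∈ I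

/-- `P` is a primal ideal of `R`: for every `n ≥ 1` and all closed two-sided ideals
`J 0, …, J (n-1)` of `R` such that `a 0 * ⋯ * a (n-1) = 0` for all choices
`a i ∈ J i`, some `J k` is contained in `P`. -/
def IsPrimalR (P : Set R) : Prop :=
  IsClosedIdealR P ∧
    ∀ (n : ℕ) (J : Fin (n + 1) → Set R), (∀ i, IsClosedIdealR (J i)) →
      (∀ a : Fin (n + 1) → R, (∀ i, a i ∈ J i) → finProd n a = 0) →
      ∃ k, J k ⊆ P

end Ideals

theorem finProd_apply_aux {A : Type*} [NonUnitalCStarAlgebra A]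
    {X : Type*} [TopologicalSpace X] (x : X) : ∀ (n : ℕ) (a : Fin (n + 1) → C(X, A)),
    (finProd n a) x = finProd n (fun i => a i x)
  | 0, a => rfl
  | n + 1, a => by
    simp only [finProd, ContinuousMap.mul_apply]
    rw [finProd_apply_aux x n]

theorem finProd_zero_aux {A : Type*} [NonUnitalRing A] : ∀ (n : ℕ) (a : Fin (n + 1) → A)
    (i : Fin (n + 1)), a i = 0 → finProd n a = 0
  | 0, a, i, h => by
    have : i = 0 := by omega
    subst this
    exact h
  | n + 1, a, i, h => by
    simp only [finProd]
    induction i using Fin.lastCases with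
    | last => rw [h, mul_zero]
    | cast j => rw [finProd_zero_aux n _ j h, zero_mul]

theorem pointwise_ideal_aux {A : Type*} [NonUnitalCStarAlgebra A]
    {X : Type*} [TopologicalSpace X] (V : Set X) (J : Set A) (hJ : IsClosedIdealR J) :
    IsClosedIdealR {f : C(X, A) | ∀ y ∈ V, f y ∈ J} where
  isClosed := by
    simp only [Set.ofPred_forall]
    exact isClosed_iInter fun y => isClosed_iInter fun _ =>
      hJ.isClosed.preimage (continuous_eval_const y)
  zero_mem := fun y _ => hJ.zero_mem
  add_mem := fun a b ha hb y hy => hJ.add_mem _ _ (ha y hy) (hb y hy)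
  neg_mem := fun a ha y hy => hJ.neg_mem _ (ha y hy)
  mul_mem_left := fun a b hb y hy => hJ.mul_mem_left _ _ (hb y hy)
  mul_mem_right := fun a b ha y hy => hJ.mul_mem_right _ _ (ha y hy)

theorem zero_ideal_aux {A : Type*} [NonUnitalCStarAlgebra A] :
    IsClosedIdealR ({0} : Set A) where
  isClosed := isClosed_singleton
  zero_mem := rfl
  add_mem := by simp
  neg_mem := by simp
  mul_mem_left := by rintro a b rfl; simp
  mul_mem_right := by rintro a b rfl; simp

theorem approx_aux {A : Type*} [NonUnitalCStarAlgebra A]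
    {X : Type*} [TopologicalSpace X] [CompactSpace X] (f : C(X, A)) (ε : ℝ) (hε : 0 < ε) :
    ∃ g : C(X, A), dist g f ≤ ε ∧ ∀ y, ‖f y‖ < ε → g y = 0 := by
  have hm : ∀ y, 0 < max ‖f y‖ ε := fun y => lt_max_of_lt_right hε
  have hc : Continuous fun y => (((1 - ε / max ‖f y‖ ε : ℝ) : ℂ)) • f y := by
    refine Continuous.smul (Complex.continuous_ofReal.comp ?_) f.continuous
    exact continuous_const.sub (continuous_const.div
      (f.continuous.norm.max continuous_const) fun y => (hm y).ne')
  refine ⟨⟨_, hc⟩, ?_, ?_⟩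
  · rw [ContinuousMap.dist_le hε.le]
    intro y
    rw [dist_eq_norm]
    have : (((1 - ε / max ‖f y‖ ε : ℝ) : ℂ)) • f y - f y
        = (((-(ε / max ‖f y‖ ε) : ℝ) : ℂ)) • f y := by
      rw [sub_eq_add_neg (1 : ℝ), Complex.ofReal_add, add_smul]
      simp
    simp only [ContinuousMap.coe_mk]
    rw [this, norm_smul, Complex.norm_real, norm_neg, Real.norm_of_nonneg (by positivity),
      div_mul_eq_mul_div, div_le_iff₀ (hm y)]
    exact mul_le_mul_of_nonneg_left (le_max_left _ _) hε.le
  · intro y hy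
    have h1 : (1 - ε / max ‖f y‖ ε : ℝ) = 0 := by
      rw [max_eq_right hy.le, div_self hε.ne', sub_self]
    simp only [ContinuousMap.coe_mk]
    rw [h1, Complex.ofReal_zero, zero_smul]

theorem exists_point_aux {A : Type*} [NonUnitalCStarAlgebra A]
    {X : Type*} [TopologicalSpace X] [CompactSpace X] [Nonempty X]
    (I : Set C(X, A)) (hI : IsPrimalR I) : ∃ x₀ : X, ∀ f : C(X, A), f x₀ = 0 → f ∈ I := by
  by_contra! hcon
  have key : ∀ x : X, ∃ V ∈ nhds x, ∃ g : C(X, A), g ∉ I ∧ ∀ y ∈ V, g y ∈ ({0} : Set A) := by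
    intro x
    obtain ⟨f, hf, hfI⟩ := hcon x
    obtain ⟨ε, hε, hb⟩ := Metric.isOpen_iff.1 hI.1.isClosed.isOpen_compl f hfI
    obtain ⟨g, hg, hg0⟩ := approx_aux f (ε / 2) (by positivity)
    refine ⟨{y | ‖f y‖ < ε / 2}, ?_, g, hb ?_, fun y hy => hg0 y hy⟩
    · exact (isOpen_lt f.continuous.norm continuous_const).mem_nhds (by simp [hf, hε])
    · rw [Metric.mem_ball]; linarith
  choose V hV g hgI hg using key
  obtain ⟨t, ht⟩ := CompactSpace.elim_nhds_subcover V hV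
  have hcov : ∀ y, ∃ x ∈ t, y ∈ V x := by
    intro y
    have : y ∈ ⋃ x ∈ t, V x := by rw [ht]; trivial
    simpa using this
  obtain ⟨n, hn⟩ : ∃ n, t.card = n + 1 := by
    obtain ⟨x, hx, _⟩ := hcov (Classical.arbitrary X)
    exact Nat.exists_eq_succ_of_ne_zero (Finset.card_ne_zero_of_mem hx)
  let e := t.equivFinOfCardEq hn
  obtain ⟨k, hk⟩ := hI.2 n (fun i => {f | ∀ y ∈ V (e.symm i), f y ∈ ({0} : Set A)})
    (fun i => pointwise_ideal_aux _ _ zero_ideal_aux) (by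
      intro a ha
      ext y
      obtain ⟨x, hx, hy⟩ := hcov y
      rw [finProd_apply_aux]
      refine finProd_zero_aux n _ (e ⟨x, hx⟩) ?_
      exact ha (e ⟨x, hx⟩) y (by simpa using hy))
  exact hgI _ (hk (hg (e.symm k)))

theorem exists_point_primal_of_primal_cstar
    {A : Type*} [NonUnitalCStarAlgebra A]
    {X : Type*} [TopologicalSpace X] [CompactSpace X] [T2Space X] [Nonempty X]
    (I : Set C(X, A)) (hI : IsPrimalR I) :
    ∃ (x₀ : X) (P : Set A), IsPrimalR P ∧ I = {f : C(X, A) | f x₀ ∈ P} := by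
  obtain ⟨x₀, h0⟩ := exists_point_aux I hI
  have hiff : ∀ f g : C(X, A), f x₀ = g x₀ → f ∈ I → g ∈ I := by
    intro f g h hf
    have := hI.1.add_mem _ _ (h0 (g - f) (by simp [h])) hf
    simpa using this
  refine ⟨x₀, {a | ContinuousMap.const X a ∈ I}, ⟨⟨?_, ?_, ?_, ?_, ?_, ?_⟩, ?_⟩, ?_⟩
  · exact hI.1.isClosed.preimage ContinuousMap.continuous_const'
  · exact hI.1.zero_mem
  · exact fun a b ha hb => hI.1.add_mem _ _ ha hb
  · exact fun a ha => hI.1.neg_mem _ ha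
  · exact fun a b hb => hI.1.mul_mem_left (ContinuousMap.const X a) _ hb
  · exact fun a b ha => hI.1.mul_mem_right _ (ContinuousMap.const X b) ha
  · intro n J hJ hprod
    obtain ⟨k, hk⟩ := hI.2 n (fun i => {f | ∀ y ∈ Set.univ, f y ∈ J i})
      (fun i => pointwise_ideal_aux _ _ (hJ i)) (by
        intro a ha
        ext y
        rw [finProd_apply_aux]
        exact hprod _ fun i => ha i y trivial)
    exact ⟨k, fun a ha => hk fun y _ => ha⟩
  · ext f
    exact ⟨fun hf => hiff f _ rfl hf, fun hf => hiff (ContinuousMap.const X (f x₀)) f rfl hf⟩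
end
end

section
/- Let X be a compact Hausdorff space, x_0 a point of X, and P a proper ideal of the TRO V. Then I_{x_0,P} := {f ∈ C(X,V) : f(x_0) ∈ P} is a minimal primal ideal of C(X,V) if and only if P is a minimal primal ideal of V. -/
noncomputable section

open ContinuousLinearMap

variable {H K : Type*} [NormedAddCommGroup H] [InnerProductSpace ℂ H] [CompleteSpace H]
  [NormedAddCommGroup K] [InnerProductSpace ℂ K] [CompleteSpace K]

/-- `P` is a minimal primal ideal of `V` with respect to the ternary product `t`:
`P` is primal and contains no strictly smaller primal ideal. -/
def IsMinPrimalT {E : Type*} [AddCommGroup E] [Module ℂ E] [TopologicalSpace E]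
    (t : E → E → E → E) (V P : Set E) : Prop :=
  IsPrimalT t V P ∧ ∀ Q : Set E, IsPrimalT t V Q → Q ⊆ P → Q = P

section Helpers

lemma ctri_apply {X : Type*} [TopologicalSpace X] (f g h : C(X, H →L[ℂ] K)) (x : X) :
    ctri f g h x = tri (f x) (g x) (h x) := rfl

lemma tri_zero_left (b c : H →L[ℂ] K) : tri 0 b c = 0 := by simp [tri]
lemma tri_zero_mid (b c : H →L[ℂ] K) : tri b 0 c = 0 := by simp [tri]
lemma tri_zero_right (b c : H →L[ℂ] K) : tri b c 0 = 0 := by simp [tri]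

lemma continuous_tri {Y : Type*} [TopologicalSpace Y] {f g h : Y → H →L[ℂ] K}
    (hf : Continuous f) (hg : Continuous g) (hh : Continuous h) :
    Continuous fun y => tri (f y) (g y) (h y) :=
  hf.clm_comp
      (((ContinuousLinearMap.adjoint :
          (H →L[ℂ] K) ≃ₗᵢ⋆[ℂ] (K →L[ℂ] H)).continuous.comp hg).clm_comp hh)

lemma oddProd_eval {X : Type*} [TopologicalSpace X] (x : X) (n : ℕ)
    (j : Fin (2 * n + 1) → C(X, H →L[ℂ] K)) :
    oddProdT ctri n j x = oddProdT tri n (fun i => j i x) := by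
  induction n with
  | zero => rfl
  | succ n ih =>
    simp only [oddProdT, ctri_apply, ih]

lemma continuous_oddProd (n : ℕ) :
    Continuous (fun j : Fin (2 * n + 1) → H →L[ℂ] K => oddProdT tri n j) := by
  induction n with
  | zero => exact continuous_apply 0
  | succ n ih =>
    simp only [oddProdT]
    refine continuous_tri (ih.comp ?_) (continuous_apply _) (continuous_apply _)
    exact continuous_pi fun i => continuous_apply _

lemma zero_ideal {V : Set (H →L[ℂ] K)} (hV : IsIdealT tri V V) :
    IsIdealT tri V {0} where
  subset := by rintro _ rfl; exact hV.zero_mem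
  isClosed := isClosed_singleton
  zero_mem := rfl
  add_mem := by rintro _ _ rfl rfl; simp
  smul_mem := by rintro c _ rfl; simp
  tri_mem_left := by rintro _ b c rfl _ _; exact tri_zero_left b c
  tri_mem_right := by rintro a b _ _ _ rfl; exact tri_zero_right a b

lemma cond_ideal {V P : Set (H →L[ℂ] K)} (hV : IsIdealT tri V V) (hP : IsIdealT tri V P)
    (p : Prop) : IsIdealT tri V {v | v ∈ V ∧ (p → v ∈ P)} := by
  by_cases hp : p
  · have : {v | v ∈ V ∧ (p → v ∈ P)} = P := by
      ext v; simp only [hp, Set.mem_ofPred_eq, true_imp_iff]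
      exact ⟨fun h => h.2, fun h => ⟨hP.subset h, h⟩⟩
    rw [this]; exact hP
  · have : {v | v ∈ V ∧ (p → v ∈ P)} = V := by
      ext v; simp [hp]
    rw [this]; exact hV

variable {X : Type*} [TopologicalSpace X]

lemma fiber_ideal {V : Set (H →L[ℂ] K)} (F : X → Set (H →L[ℂ] K))
    (hF : ∀ x, IsIdealT tri V (F x)) :
    IsIdealT (ctri (X := X)) (CXV X V) {f | ∀ x, f x ∈ F x} where
  subset := fun f hf x => (hF x).subset (hf x)
  isClosed := by
    rw [Set.ofPred_forall]
    exact isClosed_iInter fun x => (hF x).isClosed.preimage (continuous_eval_const x)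
  zero_mem := fun x => (hF x).zero_mem
  add_mem := fun a b ha hb x => (hF x).add_mem _ _ (ha x) (hb x)
  smul_mem := fun c a ha x => (hF x).smul_mem c _ (ha x)
  tri_mem_left := fun a b c ha hb hc x => (hF x).tri_mem_left _ _ _ (ha x) (hb x) (hc x)
  tri_mem_right := fun a b c ha hb hc x => (hF x).tri_mem_right _ _ _ (ha x) (hb x) (hc x)

lemma zeroOn_ideal {V : Set (H →L[ℂ] K)} (hV : IsIdealT tri V V) (S : Set X) :
    IsIdealT (ctri (X := X)) (CXV X V) {f | ∀ x, f x ∈ V ∧ (x ∈ S → f x ∈ ({0} : Set _))} :=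
  fiber_ideal (fun x => {v | v ∈ V ∧ (x ∈ S → v ∈ ({0} : Set _))})
    fun _ => cond_ideal hV (zero_ideal hV) _

lemma eval_ideal {V P : Set (H →L[ℂ] K)} (hV : IsIdealT tri V V) (hP : IsIdealT tri V P) (x₀ : X) :
    IsIdealT (ctri (X := X)) (CXV X V) {f | f ∈ CXV X V ∧ f x₀ ∈ P} := by
  have := fiber_ideal (fun x : X => {v | v ∈ V ∧ (x = x₀ → v ∈ P)})
    fun _ => cond_ideal hV hP _
  convert this using 1
  ext f
  constructor
  · rintro ⟨h1, h2⟩ x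
    exact ⟨h1 x, by rintro rfl; exact h2⟩
  · intro h
    exact ⟨fun x => (h x).1, (h x₀).2 rfl⟩

lemma image_ideal {V : Set (H →L[ℂ] K)} (hV : IsIdealT tri V V) (x₀ : X)
    {J : Set C(X, H →L[ℂ] K)} (hJ : IsIdealT ctri (CXV X V) J) :
    IsIdealT tri V (closure ((fun f : C(X, H →L[ℂ] K) => f x₀) '' J)) where
  subset := closure_minimal (by rintro _ ⟨f, hf, rfl⟩; exact hJ.subset hf x₀) hV.isClosed
  isClosed := isClosed_closure
  zero_mem := subset_closure ⟨0, hJ.zero_mem, rfl⟩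
  add_mem := fun a b ha hb => map_mem_closure₂ continuous_add ha hb (by
    rintro _ ⟨f, hf, rfl⟩ _ ⟨g, hg, rfl⟩
    exact ⟨f + g, hJ.add_mem _ _ hf hg, rfl⟩)
  smul_mem := fun c a ha => map_mem_closure (continuous_const_smul c) ha (by
    rintro _ ⟨f, hf, rfl⟩
    exact ⟨c • f, hJ.smul_mem _ _ hf, rfl⟩)
  tri_mem_left := fun a b c ha hb hc =>
    map_mem_closure (f := fun a => tri a b c)
      (continuous_tri continuous_id continuous_const continuous_const) ha (by
    rintro _ ⟨f, hf, rfl⟩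
    exact ⟨ctri f (.const X b) (.const X c),
      hJ.tri_mem_left _ _ _ hf (fun _ => hb) (fun _ => hc), rfl⟩)
  tri_mem_right := fun a b c ha hb hc =>
    map_mem_closure (f := fun c => tri a b c)
      (continuous_tri continuous_const continuous_const continuous_id) hc (by
    rintro _ ⟨f, hf, rfl⟩
    exact ⟨ctri (.const X a) (.const X b) f,
      hJ.tri_mem_right _ _ _ (fun _ => ha) (fun _ => hb) hf, rfl⟩)

lemma eval_primal {V P : Set (H →L[ℂ] K)} (hV : IsIdealT tri V V) (hP : IsPrimalT tri V P)
    (x₀ : X) :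
    IsPrimalT (ctri (X := X)) (CXV X V) {f | f ∈ CXV X V ∧ f x₀ ∈ P} := by
  refine ⟨eval_ideal hV hP.1 x₀, fun n hn J hJ h0 => ?_⟩
  obtain ⟨k, hk⟩ := hP.2 n hn
    (fun i => closure ((fun f : C(X, H →L[ℂ] K) => f x₀) '' J i))
    (fun i => image_ideal hV x₀ (hJ i)) (by
      intro j hj
      have hc : IsClosed {j : Fin (2 * n + 1) → H →L[ℂ] K | oddProdT tri n j = 0} :=
        isClosed_eq (continuous_oddProd n) continuous_const
      have hsub : Set.pi Set.univ (fun i => (fun f : C(X, H →L[ℂ] K) => f x₀) '' J i) ⊆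
          {j : Fin (2 * n + 1) → H →L[ℂ] K | oddProdT tri n j = 0} := by
        intro j hj
        choose g hg hgj using fun i => hj i (Set.mem_univ i)
        have := congrArg (fun f => f x₀) (h0 g hg)
        simp only [oddProd_eval] at this
        simp only [hgj] at this
        exact this
      have := closure_minimal hsub hc
      rw [closure_pi_set] at this
      exact this fun i _ => hj i)
  exact ⟨k, fun f hf => ⟨(hJ k).subset hf, hk (subset_closure ⟨f, hf, rfl⟩)⟩⟩

lemma const_tri (a b c : H →L[ℂ] K) : ContinuousMap.const X (tri a b c) =
    ctri (.const X a) (.const X b) (.const X c) := rfl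

lemma const_primal {V : Set (H →L[ℂ] K)} (x₀ : X)
    {Q : Set C(X, H →L[ℂ] K)} (hQ : IsPrimalT ctri (CXV X V) Q) :
    IsPrimalT tri V {v | ContinuousMap.const X v ∈ Q} := by
  refine ⟨?_, fun n hn J hJ h0 => ?_⟩
  · have hI := hQ.1
    exact
    { subset := fun v hv => hI.subset hv x₀
      isClosed := hI.isClosed.preimage ContinuousMap.continuous_const'
      zero_mem := hI.zero_mem
      add_mem := fun a b ha hb => hI.add_mem _ _ ha hb
      smul_mem := fun c a ha => hI.smul_mem c _ ha
      tri_mem_left := fun a b c ha hb hc =>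
by
        rw [Set.mem_ofPred_eq, const_tri]
        exact hI.tri_mem_left _ _ _ ha (fun _ => hb) (fun _ => hc)
      tri_mem_right := fun a b c ha hb hc =>
by
        rw [Set.mem_ofPred_eq, const_tri]
        exact hI.tri_mem_right _ _ _ (fun _ => ha) (fun _ => hb) hc }
  · obtain ⟨k, hk⟩ := hQ.2 n hn (fun i => {f | ∀ x, f x ∈ J i})
      (fun i => fiber_ideal _ fun _ => hJ i) (by
        intro j hj
        ext1 x
        rw [oddProd_eval, h0 _ fun i => hj i x]
        rfl)
    exact ⟨k, fun v hv => hk fun _ => hv⟩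

lemma vanish_mem [CompactSpace X] [T2Space X] {V P : Set (H →L[ℂ] K)}
    (hV : IsIdealT tri V V) (hP : IsIdealT tri V P) (hne : P ≠ V) (x₀ : X)
    {Q : Set C(X, H →L[ℂ] K)} (hQ : IsPrimalT ctri (CXV X V) Q)
    (hQP : Q ⊆ {f | f ∈ CXV X V ∧ f x₀ ∈ P}) (f : C(X, H →L[ℂ] K)) (hf : f ∈ CXV X V)
    (hf0 : f x₀ = 0) : f ∈ Q := by
  obtain ⟨v, hvV, hvP⟩ : ∃ v ∈ V, v ∉ P := by
    by_contra! h
    exact hne (hP.subset.antisymm h)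
  have key : ∀ W : Set X, IsOpen W → x₀ ∈ W → ∀ g ∈ CXV X V, (∀ x ∈ W, g x = 0) → g ∈ Q := by
    intro W hW hx g hg hgW
    obtain ⟨k, hk⟩ := hQ.2 1 le_rfl
      ![{f | ∀ x, f x ∈ V ∧ (x ∈ Wᶜ → f x ∈ ({0} : Set _))},
        {f | ∀ x, f x ∈ V ∧ (x ∈ W → f x ∈ ({0} : Set _))},
        {f | ∀ x, f x ∈ V ∧ (x ∈ W → f x ∈ ({0} : Set _))}]
      (by
        intro i
        fin_cases i
        · exact zeroOn_ideal hV Wᶜ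
        · exact zeroOn_ideal hV W
        · exact zeroOn_ideal hV W) (by
        intro j hj
        ext1 x
        have h0 := (hj 0 x).2
        have h1 := (hj 1 x).2
        change tri (j 0 x) (j 1 x) (j 2 x) = 0
        by_cases hxW : x ∈ W
        · have : j 1 x = 0 := h1 hxW
          rw [this, tri_zero_mid]
        · have : j 0 x = 0 := h0 hxW
          rw [this, tri_zero_left])
    have hgm : g ∈ {f : C(X, H →L[ℂ] K) | ∀ x, f x ∈ V ∧ (x ∈ W → f x ∈ ({0} : Set _))} :=
      fun x => ⟨hg x, fun h => hgW x h⟩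
    fin_cases k
    · exfalso
      obtain ⟨φ, hφ0, hφ1, -⟩ := exists_continuous_zero_one_of_isClosed
        (hW.isClosed_compl) (isClosed_singleton (x := x₀))
        (by simpa using hx)
      let u : C(X, H →L[ℂ] K) := ⟨fun x => ((φ x : ℝ) : ℂ) • v, by fun_prop⟩
      have hu : u ∈ Q := hk (by
        intro x
        refine ⟨hV.smul_mem _ _ hvV, fun hx => ?_⟩
        change ((φ x : ℝ) : ℂ) • v = 0
        rw [hφ0 hx]; simp)
      have := (hQP hu).2
      change ((φ x₀ : ℝ) : ℂ) • v ∈ P at this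
      rw [hφ1 rfl] at this
      exact hvP (by simpa using this)
    · exact hk hgm
    · exact hk hgm
  refine hQ.1.isClosed.closure_eq.subset ((Metric.mem_closure_iff (α := C(X, H →L[ℂ] K)) (s := Q) (a := f)).2 ?_)
  intro ε hε
  set δ := ε / 2 with hδ
  have hδ0 : 0 < δ := by positivity
  have hm : ∀ x, 0 < max ‖f x‖ δ := fun x => lt_max_of_lt_right hδ0
  let g : C(X, H →L[ℂ] K) :=
    ⟨fun x => ((1 - δ / max ‖f x‖ δ : ℝ) : ℂ) • f x, by
      have : Continuous fun x => δ / max ‖f x‖ δ :=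
        continuous_const.div (by fun_prop) fun x => (hm x).ne'
      exact (Complex.continuous_ofReal.comp (continuous_const.sub this)).smul f.continuous⟩
  refine ⟨g, key {x | ‖f x‖ < δ} (isOpen_lt (by fun_prop) continuous_const) (by simpa [hf0])
    g (fun x => hV.smul_mem _ _ (hf x)) ?_, ?_⟩
  · intro x hx
    change ((1 - δ / max ‖f x‖ δ : ℝ) : ℂ) • f x = 0
    rw [max_eq_right (le_of_lt hx), div_self hδ0.ne']
    simp
  · refine lt_of_le_of_lt ((ContinuousMap.dist_le hδ0.le).2 fun x => ?_) (half_lt_self hε)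
    have : f x - g x = ((δ / max ‖f x‖ δ : ℝ) : ℂ) • f x := by
      change f x - ((1 - δ / max ‖f x‖ δ : ℝ) : ℂ) • f x = _
      rw [Complex.ofReal_sub, sub_smul]; simp
    rw [dist_eq_norm, this, norm_smul, Complex.norm_real, Real.norm_eq_abs,
      abs_of_nonneg (div_nonneg hδ0.le (hm x).le), div_mul_eq_mul_div, div_le_iff₀ (hm x)]
    exact mul_le_mul_of_nonneg_left (le_max_left _ _) hδ0.le

end Helpers

/-- If `X` is a compact Hausdorff space, `x₀ ∈ X` and `P` is a proper
ideal of the TRO `V`, then `I_{x₀,P} = {f ∈ C(X,V) : f x₀ ∈ P}` is a minimal primal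
ideal of `C(X,V)` if and only if `P` is a minimal primal ideal of `V`. -/
theorem minPrimal_eval_ideal_iff_minPrimal
    {X : Type*} [TopologicalSpace X] [CompactSpace X] [T2Space X] (x₀ : X)
    (V : Set (H →L[ℂ] K)) (hV : IsIdealT (tri (H := H) (K := K)) V V)
    (P : Set (H →L[ℂ] K)) (hP : IsIdealT tri V P) (hPproper : P ≠ V) :
    IsMinPrimalT (ctri (X := X)) (CXV X V)
        {f : C(X, H →L[ℂ] K) | f ∈ CXV X V ∧ f x₀ ∈ P} ↔
      IsMinPrimalT tri V P := by
  constructor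
  · rintro ⟨h1, h2⟩
    refine ⟨?_, fun Q hQ hQP => ?_⟩
    · have := const_primal x₀ h1
      convert this using 1
      ext v
      exact ⟨fun hv => ⟨fun _ => hP.subset hv, hv⟩, fun hv => hv.2⟩
    · have h := h2 _ (eval_primal hV hQ x₀) fun f hf => ⟨hf.1, hQP hf.2⟩
      refine hQP.antisymm fun v hv => ?_
      have hm : ContinuousMap.const X v ∈ {f : C(X, H →L[ℂ] K) | f ∈ CXV X V ∧ f x₀ ∈ P} :=
        ⟨fun _ => hP.subset hv, hv⟩
      rw [← h] at hm
      exact hm.2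
  · rintro ⟨h1, h2⟩
    refine ⟨eval_primal hV h1 x₀, fun Q hQ hQP => hQP.antisymm ?_⟩
    have hQ' := h2 _ (const_primal x₀ hQ) fun v hv => (hQP hv).2
    rintro f ⟨hf, hfP⟩
    have hc : ContinuousMap.const X (f x₀) ∈ Q := by rw [← hQ'] at hfP; exact hfP
    have hd : f + (-1 : ℂ) • ContinuousMap.const X (f x₀) ∈ Q := by
      refine vanish_mem hV hP hPproper x₀ hQ hQP _ (fun x => ?_) ?_
      · exact hV.add_mem _ _ (hf x) (hV.smul_mem _ _ (hf x₀))
      · simp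
    have := hQ.1.add_mem _ _ hd hc
    have e : f + (-1 : ℂ) • ContinuousMap.const X (f x₀) + ContinuousMap.const X (f x₀) = f := by
      ext1 x
      simp
    rwa [e] at this
end
end
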